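/- Let (p, x, σ, β) be admissible parameters with z = p − Σ_{i=1}^{n−1} x_i²/σ_i > 0, and let R be the curvature operator of the inner product ⟨·,·⟩ = S(p, x, σ, β) on 𝔠𝔥(n). Then for every i ∈ {1,…,n−1}: R(X, Z_i) = (1/(4zσ_i))·(−σ_i·X∧Z_i − 2x_i·X∧W + x_i·Σ_{l=1}^{n−1}(x_l/σ_l)·Y_l∧W + z·Y_i∧W) as endomorphisms of 𝔠𝔥(n). -/

import Mathlib

noncomputable section

open Matrix BigOperators Finset

namespace CHn

/-- Structure constants of the Lie algebra 𝔠𝔥(n) in the ordered basis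
`(X, Y_1, …, Y_{n-1}, Z_1, …, Z_{n-1}, W)`:
index `0 ↦ X`, indices `1,…,n-1 ↦ Y_1,…,Y_{n-1}`,
indices `n,…,2n-2 ↦ Z_1,…,Z_{n-1}`, index `2n-1 ↦ W`.
The nonzero brackets are `[X,Y_i] = (1/2)Y_i`, `[X,Z_i] = (1/2)Z_i`,
`[X,W] = W`, `[Z_j,Y_i] = δ_{ij} W`. -/
def structC (n : ℕ) (i j k : Fin (2 * n)) : ℝ :=
  (if i.val = 0 ∧ j = k ∧ 1 ≤ j.val ∧ j.val ≤ 2 * n - 2 then (1 : ℝ) / 2 else 0)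
  - (if j.val = 0 ∧ i = k ∧ 1 ≤ i.val ∧ i.val ≤ 2 * n - 2 then (1 : ℝ) / 2 else 0)
  + (if i.val = 0 ∧ j.val = 2 * n - 1 ∧ k.val = 2 * n - 1 then (1 : ℝ) else 0)
  - (if j.val = 0 ∧ i.val = 2 * n - 1 ∧ k.val = 2 * n - 1 then (1 : ℝ) else 0)
  + (if n ≤ i.val ∧ i.val ≤ 2 * n - 2 ∧ i.val = j.val + (n - 1) ∧ k.val = 2 * n - 1
      then (1 : ℝ) else 0)
  - (if n ≤ j.val ∧ j.val ≤ 2 * n - 2 ∧ j.val = i.val + (n - 1) ∧ k.val = 2 * n - 1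
      then (1 : ℝ) else 0)

/-- The Lie bracket of `𝔠𝔥(n)`, as a bilinear operation on coordinate vectors. -/
def bracket (n : ℕ) (u v : Fin (2 * n) → ℝ) : Fin (2 * n) → ℝ :=
  fun k => ∑ i, ∑ j, u i * v j * structC n i j k

/-- `F` is the matrix (in the ordered basis) of a Lie algebra automorphism of `𝔠𝔥(n)`. -/
def IsAut (n : ℕ) (F : Matrix (Fin (2 * n)) (Fin (2 * n)) ℝ) : Prop :=
  IsUnit F ∧ ∀ u v, F.mulVec (bracket n u v) = bracket n (F.mulVec u) (F.mulVec v)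

/-- The normal form `S(p, x, σ, β)`: the block matrix
`[[p, xᵀ, 0, 0], [x, σ, 0, 0], [0, 0, σ, 0], [0, 0, 0, β]]`
with blocks of sizes `1, n-1, n-1, 1`. -/
def Sform (n : ℕ) (p : ℝ) (x σ : Fin (n - 1) → ℝ) (β : ℝ) :
    Matrix (Fin (2 * n)) (Fin (2 * n)) ℝ := fun i j =>
  if i.val = 0 ∧ j.val = 0 then p
  else if h : i.val = 0 ∧ 1 ≤ j.val ∧ j.val ≤ n - 1 then x ⟨j.val - 1, by omega⟩
  else if h : j.val = 0 ∧ 1 ≤ i.val ∧ i.val ≤ n - 1 then x ⟨i.val - 1, by omega⟩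
  else if h : i = j ∧ 1 ≤ i.val ∧ i.val ≤ n - 1 then σ ⟨i.val - 1, by omega⟩
  else if h : i = j ∧ n ≤ i.val ∧ i.val ≤ 2 * n - 2 then σ ⟨i.val - n, by omega⟩
  else if i = j ∧ i.val = 2 * n - 1 then β
  else 0

/-- Admissibility of the parameters `(p, x, σ, β)`:
`p, β > 0`, all `x_i ≥ 0`, `σ_1 ≥ … ≥ σ_{n-2} ≥ 1` and the convention `σ_{n-1} = 1`. -/
def Admissible (n : ℕ) (p : ℝ) (x σ : Fin (n - 1) → ℝ) (β : ℝ) : Prop :=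
  0 < p ∧ 0 < β ∧ (∀ i, 0 ≤ x i) ∧ Antitone σ ∧ (∀ i, 1 ≤ σ i) ∧
    ∀ _h : 1 ≤ n - 1, σ ⟨n - 2, by omega⟩ = 1

/-- `z = p - Σ_i x_i² / σ_i`. -/
def zval (n : ℕ) (p : ℝ) (x σ : Fin (n - 1) → ℝ) : ℝ :=
  p - ∑ i, (x i) ^ 2 / σ i

/-- The inner product on `𝔠𝔥(n)` determined by a matrix `S`. -/
def ip (n : ℕ) (S : Matrix (Fin (2 * n)) (Fin (2 * n)) ℝ) (u v : Fin (2 * n) → ℝ) : ℝ :=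
  u ⬝ᵥ S.mulVec v

/-- The coordinates (w.r.t. the standard basis) of the Koszul form
`K(u,v)(T) = ⟨[u,v],T⟩ - ⟨[v,T],u⟩ + ⟨[T,u],v⟩`. -/
def koszul (n : ℕ) (S : Matrix (Fin (2 * n)) (Fin (2 * n)) ℝ)
    (u v : Fin (2 * n) → ℝ) : Fin (2 * n) → ℝ := fun t =>
  ip n S (bracket n u v) (Pi.single t 1) - ip n S (bracket n v (Pi.single t 1)) u
    + ip n S (bracket n (Pi.single t 1) u) v

/-- The Levi-Civita product `∇_u v` of the inner product `S`,
i.e. the unique solution of the Koszul formula `2⟨∇_u v, T⟩ = K(u,v)(T)`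
(for invertible symmetric `S`). -/
def nabla (n : ℕ) (S : Matrix (Fin (2 * n)) (Fin (2 * n)) ℝ)
    (u v : Fin (2 * n) → ℝ) : Fin (2 * n) → ℝ :=
  (2 : ℝ)⁻¹ • (S⁻¹).mulVec (koszul n S u v)

/-- The curvature operator `R(u,v)w = ∇_u∇_v w - ∇_v∇_u w - ∇_{[u,v]} w`. -/
def curv (n : ℕ) (S : Matrix (Fin (2 * n)) (Fin (2 * n)) ℝ)
    (u v w : Fin (2 * n) → ℝ) : Fin (2 * n) → ℝ :=
  nabla n S u (nabla n S v w) - nabla n S v (nabla n S u w) - nabla n S (bracket n u v) w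

/-- The Ricci form `Ric(u,v) = tr (T ↦ R(T,u)v)`. -/
def ricci (n : ℕ) (S : Matrix (Fin (2 * n)) (Fin (2 * n)) ℝ)
    (u v : Fin (2 * n) → ℝ) : ℝ :=
  ∑ t, curv n S (Pi.single t 1) u v t

/-- The scalar curvature `τ = Σ_{i,j} g^{ij} Ric(e_i, e_j)`. -/
def scalarCurv (n : ℕ) (S : Matrix (Fin (2 * n)) (Fin (2 * n)) ℝ) : ℝ :=
  ∑ i, ∑ j, (S⁻¹) i j * ricci n S (Pi.single i 1) (Pi.single j 1)

/-- The wedge endomorphism `(u∧v)(w) = ⟨v,w⟩u - ⟨u,w⟩v`. -/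
def wedge (n : ℕ) (S : Matrix (Fin (2 * n)) (Fin (2 * n)) ℝ)
    (u v : Fin (2 * n) → ℝ) : (Fin (2 * n) → ℝ) → (Fin (2 * n) → ℝ) :=
  fun w => ip n S v w • u - ip n S u w • v

/-- The standard symplectic matrix `J_m = [[0, I_m], [-I_m, 0]]`. -/
def Jmat (m : ℕ) : Matrix (Fin (2 * m)) (Fin (2 * m)) ℝ := fun i j =>
  if j.val = i.val + m then 1 else if i.val = j.val + m then -1 else 0

/-- The block matrix `[[1, 0, 0], [u, M, 0], [a, vᵀ, λ]]`
with blocks of sizes `1, 2n-2, 1`. -/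
def blockF (n : ℕ) (M : Matrix (Fin (2 * (n - 1))) (Fin (2 * (n - 1))) ℝ)
    (u v : Fin (2 * (n - 1)) → ℝ) (a lam : ℝ) :
    Matrix (Fin (2 * n)) (Fin (2 * n)) ℝ := fun i j =>
  if i.val = 0 then (if j.val = 0 then 1 else 0)
  else if h : 1 ≤ i.val ∧ i.val ≤ 2 * n - 2 then
    (if j.val = 0 then u ⟨i.val - 1, by omega⟩
     else if h2 : 1 ≤ j.val ∧ j.val ≤ 2 * n - 2 then
       M ⟨i.val - 1, by omega⟩ ⟨j.val - 1, by omega⟩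
     else 0)
  else
    (if j.val = 0 then a
     else if h2 : 1 ≤ j.val ∧ j.val ≤ 2 * n - 2 then v ⟨j.val - 1, by omega⟩
     else lam)

/-- The metric is Einstein: the Ricci form is proportional to the inner product. -/
def IsEinstein (n : ℕ) (S : Matrix (Fin (2 * n)) (Fin (2 * n)) ℝ) : Prop :=
  ∃ c : ℝ, ∀ u v, ricci n S u v = c * ip n S u v

end CHn


namespace CHn

set_option linter.unusedSimpArgs false

lemma iX_lt (n : ℕ) (hn : 2 ≤ n) : 0 < 2 * n := by omega
lemma iY_lt (n : ℕ) (i : Fin (n - 1)) : i.val + 1 < 2 * n := by have := i.isLt; omega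
lemma iZ_lt (n : ℕ) (i : Fin (n - 1)) : i.val + n < 2 * n := by have := i.isLt; omega
lemma iW_lt (n : ℕ) (hn : 2 ≤ n) : 2 * n - 1 < 2 * n := by omega

/-- index of `X` -/
def iX (n : ℕ) (hn : 2 ≤ n) : Fin (2 * n) := ⟨0, iX_lt n hn⟩
/-- index of `Y_i` -/
def iY (n : ℕ) (i : Fin (n - 1)) : Fin (2 * n) := ⟨i.val + 1, iY_lt n i⟩
/-- index of `Z_i` -/
def iZ (n : ℕ) (i : Fin (n - 1)) : Fin (2 * n) := ⟨i.val + n, iZ_lt n i⟩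
/-- index of `W` -/
def iW (n : ℕ) (hn : 2 ≤ n) : Fin (2 * n) := ⟨2 * n - 1, iW_lt n hn⟩

lemma idx_cases (n : ℕ) (hn : 2 ≤ n) {P : Fin (2 * n) → Prop} (hX : P (iX n hn))
    (hY : ∀ i, P (iY n i)) (hZ : ∀ i, P (iZ n i)) (hW : P (iW n hn)) : ∀ k, P k := by
  intro k
  have hk := k.isLt
  by_cases h0 : k.val = 0
  · have : k = iX n hn := Fin.ext h0
    rwa [this]
  by_cases h1 : k.val ≤ n - 1
  · have : k = iY n ⟨k.val - 1, by omega⟩ := Fin.ext (by simp only [iY]; omega)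
    rw [this]; exact hY _
  by_cases h2 : k.val ≤ 2 * n - 2
  · have : k = iZ n ⟨k.val - n, by omega⟩ := Fin.ext (by simp only [iZ]; omega)
    rw [this]; exact hZ _
  · have : k = iW n hn := Fin.ext (by simp only [iW]; omega)
    rwa [this]

lemma sum_split (n : ℕ) (hn : 2 ≤ n) (f : Fin (2 * n) → ℝ) :
    ∑ k, f k = f (iX n hn) + ∑ i, f (iY n i) + ∑ i, f (iZ n i) + f (iW n hn) := by
  let e : Unit ⊕ (Fin (n - 1) ⊕ (Fin (n - 1) ⊕ Unit)) → Fin (2 * n) :=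
    Sum.elim (fun _ => iX n hn) (Sum.elim (iY n) (Sum.elim (iZ n) (fun _ => iW n hn)))
  have he : Function.Bijective e := by
    constructor
    · rintro (⟨⟩ | i | i | ⟨⟩) (⟨⟩ | j | j | ⟨⟩) h <;>
        simp only [e, Sum.elim_inl, Sum.elim_inr, iX, iY, iZ, iW, Fin.mk.injEq] at h <;>
        first
          | rfl
          | (exfalso; omega)
          | (have : i = j := Fin.ext (by omega)
             rw [this])
    · refine idx_cases n hn ⟨Sum.inl (), rfl⟩ (fun i => ⟨Sum.inr (Sum.inl i), rfl⟩)
        (fun i => ⟨Sum.inr (Sum.inr (Sum.inl i)), rfl⟩) ⟨Sum.inr (Sum.inr (Sum.inr ())), rfl⟩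
  rw [← he.sum_comp]
  simp [e, Fintype.sum_sum_type]
  ring

section
variable (n : ℕ) (hn : 2 ≤ n) (i j : Fin (n - 1))

lemma XY : iX n hn = iY n i ↔ False := by simp [iX, iY]
lemma XZ : iX n hn = iZ n i ↔ False := by simp only [iX, iZ, Fin.mk.injEq, iff_false]; omega
lemma XW : iX n hn = iW n hn ↔ False := by simp only [iX, iW, Fin.mk.injEq, iff_false]; omega
lemma YX : iY n i = iX n hn ↔ False := by simp [iX, iY]
lemma ZX : iZ n i = iX n hn ↔ False := by simp only [iX, iZ, Fin.mk.injEq, iff_false]; omega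
lemma WX : iW n hn = iX n hn ↔ False := by simp only [iX, iW, Fin.mk.injEq, iff_false]; omega
lemma YZ : iY n i = iZ n j ↔ False := by simp only [iY, iZ, Fin.mk.injEq, iff_false]; omega
lemma ZY : iZ n i = iY n j ↔ False := by simp only [iY, iZ, Fin.mk.injEq, iff_false]; omega
lemma YW : iY n i = iW n hn ↔ False := by simp only [iY, iW, Fin.mk.injEq, iff_false]; omega
lemma WY : iW n hn = iY n i ↔ False := by simp only [iY, iW, Fin.mk.injEq, iff_false]; omega
lemma ZW : iZ n i = iW n hn ↔ False := by simp only [iZ, iW, Fin.mk.injEq, iff_false]; omega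
lemma WZ : iW n hn = iZ n i ↔ False := by simp only [iZ, iW, Fin.mk.injEq, iff_false]; omega
lemma YY : iY n i = iY n j ↔ i = j := by simp [iY, Fin.ext_iff]
lemma ZZ : iZ n i = iZ n j ↔ i = j := by simp [iZ, Fin.ext_iff]

variable (a b k : Fin (2 * n))

lemma structC_X : structC n a b (iX n hn) = 0 := by
  grind (splits := 40) [structC, iX]

lemma structC_Y : structC n a b (iY n i) = (if a = iX n hn then (if b = iY n i then 1/2 else 0) else 0)
    - (if a = iY n i then (if b = iX n hn then 1/2 else 0) else 0) := by
  grind (splits := 40) [structC, iX, iY]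

lemma structC_Z : structC n a b (iZ n i) = (if a = iX n hn then (if b = iZ n i then 1/2 else 0) else 0)
    - (if a = iZ n i then (if b = iX n hn then 1/2 else 0) else 0) := by
  grind (splits := 40) [structC, iX, iZ]

lemma structC_XW : structC n (iX n hn) b (iW n hn) = (if b = iW n hn then 1 else 0) := by
  grind (splits := 40) [structC, iX, iW]
lemma structC_WW : structC n (iW n hn) b (iW n hn) = (if b = iX n hn then -1 else 0) := by
  grind (splits := 40) [structC, iX, iW]
lemma structC_YW : structC n (iY n i) b (iW n hn) = (if b = iZ n i then -1 else 0) := by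
  grind (splits := 40) [structC, iY, iZ, iW]
lemma structC_ZW : structC n (iZ n i) b (iW n hn) = (if b = iY n i then 1 else 0) := by
  grind (splits := 40) [structC, iY, iZ, iW]

variable (u v : Fin (2 * n) → ℝ)

lemma bracket_X : bracket n u v (iX n hn) = 0 := by simp [bracket, structC_X]
lemma bracket_Y : bracket n u v (iY n i) =
    (u (iX n hn) * v (iY n i) - u (iY n i) * v (iX n hn)) / 2 := by
  simp only [bracket, structC_Y n hn, mul_sub, Finset.sum_sub_distrib]
  simp
  ring
lemma bracket_Z : bracket n u v (iZ n i) =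
    (u (iX n hn) * v (iZ n i) - u (iZ n i) * v (iX n hn)) / 2 := by
  simp only [bracket, structC_Z n hn, mul_sub, Finset.sum_sub_distrib]
  simp
  ring
lemma bracket_W : bracket n u v (iW n hn) =
    u (iX n hn) * v (iW n hn) - u (iW n hn) * v (iX n hn)
     - ∑ i, u (iY n i) * v (iZ n i) + ∑ i, u (iZ n i) * v (iY n i) := by
  simp only [bracket]
  rw [sum_split n hn]
  simp only [structC_XW, structC_YW, structC_ZW, structC_WW]
  simp
  ring

variable (p β : ℝ) (x σ : Fin (n - 1) → ℝ)

lemma S_X : Sform n p x σ β (iX n hn) (iX n hn) = p := by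
  grind (splits := 40) [Sform, iX, iY, iZ, iW]
lemma S_XY : Sform n p x σ β (iX n hn) (iY n i) = x i := by
  grind (splits := 40) [Sform, iX, iY, iZ, iW]
lemma S_YX : Sform n p x σ β (iY n i) (iX n hn) = x i := by
  grind (splits := 40) [Sform, iX, iY, iZ, iW]
lemma S_XZ : Sform n p x σ β (iX n hn) (iZ n i) = 0 := by
  grind (splits := 40) [Sform, iX, iY, iZ, iW]
lemma S_ZX : Sform n p x σ β (iZ n i) (iX n hn) = 0 := by
  grind (splits := 40) [Sform, iX, iY, iZ, iW]
lemma S_XW : Sform n p x σ β (iX n hn) (iW n hn) = 0 := by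
  grind (splits := 40) [Sform, iX, iY, iZ, iW]
lemma S_WX : Sform n p x σ β (iW n hn) (iX n hn) = 0 := by
  grind (splits := 40) [Sform, iX, iY, iZ, iW]
lemma S_YY : Sform n p x σ β (iY n i) (iY n j) = if i = j then σ i else 0 := by
  grind (splits := 40) [Sform, iX, iY, iZ, iW]
lemma S_YZ : Sform n p x σ β (iY n i) (iZ n j) = 0 := by
  grind (splits := 40) [Sform, iX, iY, iZ, iW]
lemma S_ZY : Sform n p x σ β (iZ n i) (iY n j) = 0 := by
  grind (splits := 40) [Sform, iX, iY, iZ, iW]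
lemma S_YW : Sform n p x σ β (iY n i) (iW n hn) = 0 := by
  grind (splits := 40) [Sform, iX, iY, iZ, iW]
lemma S_WY : Sform n p x σ β (iW n hn) (iY n i) = 0 := by
  grind (splits := 40) [Sform, iX, iY, iZ, iW]
lemma S_ZZ : Sform n p x σ β (iZ n i) (iZ n j) = if i = j then σ i else 0 := by
  grind (splits := 40) [Sform, iX, iY, iZ, iW]
lemma S_ZW : Sform n p x σ β (iZ n i) (iW n hn) = 0 := by
  grind (splits := 40) [Sform, iX, iY, iZ, iW]
lemma S_WZ : Sform n p x σ β (iW n hn) (iZ n i) = 0 := by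
  grind (splits := 40) [Sform, iX, iY, iZ, iW]
lemma S_WW : Sform n p x σ β (iW n hn) (iW n hn) = β := by
  grind (splits := 40) [Sform, iX, iY, iZ, iW]

lemma Sv_X : (Sform n p x σ β).mulVec v (iX n hn) = p * v (iX n hn) + ∑ l, x l * v (iY n l) := by
  simp only [mulVec, dotProduct]
  rw [sum_split n hn]
  simp [S_X, S_XY, S_XZ, S_XW]
lemma Sv_Y : (Sform n p x σ β).mulVec v (iY n i) = x i * v (iX n hn) + σ i * v (iY n i) := by
  simp only [mulVec, dotProduct]
  rw [sum_split n hn]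
  simp [S_YX, S_YY, S_YZ, S_YW]
lemma Sv_Z (hn : 2 ≤ n) : (Sform n p x σ β).mulVec v (iZ n i) = σ i * v (iZ n i) := by
  simp only [mulVec, dotProduct]
  rw [sum_split n hn]
  simp [S_ZX, S_ZY, S_ZZ, S_ZW]
lemma Sv_W : (Sform n p x σ β).mulVec v (iW n hn) = β * v (iW n hn) := by
  simp only [mulVec, dotProduct]
  rw [sum_split n hn]
  simp [S_WX, S_WY, S_WZ, S_WW]

lemma ip_eq : ip n (Sform n p x σ β) u v =
    u (iX n hn) * (p * v (iX n hn) + ∑ l, x l * v (iY n l))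
    + ∑ l, u (iY n l) * (x l * v (iX n hn) + σ l * v (iY n l))
    + ∑ l, u (iZ n l) * (σ l * v (iZ n l))
    + u (iW n hn) * (β * v (iW n hn)) := by
  simp only [ip, dotProduct]
  rw [sum_split n hn]
  simp only [Sv_X, Sv_Y n hn, Sv_Z (hn := hn), Sv_W]

lemma S_inj (hn : 2 ≤ n) (hβ : 0 < β) (hσ : ∀ i, 0 < σ i) (hz : 0 < zval n p x σ)
    (h : (Sform n p x σ β).mulVec v = 0) : v = 0 := by
  have hX := congrFun h (iX n hn)
  have hY := fun i => congrFun h (iY n i)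
  have hZ := fun i => congrFun h (iZ n i)
  have hW := congrFun h (iW n hn)
  simp only [Sv_X, Sv_Y n hn, Sv_Z (hn := hn), Sv_W, Pi.zero_apply] at hX hY hZ hW
  have hy : ∀ i, v (iY n i) = - (x i / σ i * v (iX n hn)) := fun i => by
    have := hY i
    have := hσ i
    field_simp
    linarith
  have h0 : v (iX n hn) = 0 := by
    have : zval n p x σ * v (iX n hn) = 0 := by
      rw [← hX, zval, sub_mul, Finset.sum_mul, sub_eq_add_neg, ← Finset.sum_neg_distrib]
      congr 1
      refine Finset.sum_congr rfl fun l _ => ?_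
      rw [hy]; ring
    exact (mul_eq_zero.1 this).resolve_left hz.ne'
  funext k
  revert k
  refine idx_cases n hn h0 (fun i => ?_) (fun i => ?_) ?_
  · simp [hy, h0]
  · exact (mul_eq_zero.1 (hZ i)).resolve_left (hσ i).ne'
  · exact (mul_eq_zero.1 hW).resolve_left hβ.ne'

lemma nabla_eq (hn : 2 ≤ n) (hβ : 0 < β) (hσ : ∀ i, 0 < σ i) (hz : 0 < zval n p x σ)
    (c : Fin (2 * n) → ℝ)
    (h : ∀ k, 2 * (Sform n p x σ β).mulVec c k = koszul n (Sform n p x σ β) u v k) :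
    nabla n (Sform n p x σ β) u v = c := by
  have hu : IsUnit (Sform n p x σ β) := by
    rw [← Matrix.mulVec_injective_iff_isUnit]
    intro a b hab
    have := S_inj (hn := hn) (v := a - b) (hσ := hσ) (hβ := hβ) (hz := hz) (h := by rw [Matrix.mulVec_sub]; exact sub_eq_zero.2 hab)
    exact sub_eq_zero.1 this
  have hk : koszul n (Sform n p x σ β) u v = (2:ℝ) • (Sform n p x σ β).mulVec c := by
    funext k; simp [← h]
  rw [nabla, hk, Matrix.mulVec_smul, Matrix.mulVec_mulVec,
    Matrix.nonsing_inv_mul _ ((Matrix.isUnit_iff_isUnit_det _).1 hu)]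
  simp

/-- vector from components -/
def mk (a : ℝ) (y ζ : Fin (n - 1) → ℝ) (w : ℝ) : Fin (2 * n) → ℝ :=
  a • Pi.single (iX n hn) 1 + (∑ i, y i • Pi.single (iY n i) 1)
   + (∑ i, ζ i • Pi.single (iZ n i) 1) + w • Pi.single (iW n hn) 1

variable (a : ℝ) (y ζ : Fin (n - 1) → ℝ) (w : ℝ)
lemma mk_X : mk n hn a y ζ w (iX n hn) = a := by
  simp [mk, Pi.single_apply, XY, XZ, XW]
lemma mk_Y : mk n hn a y ζ w (iY n i) = y i := by
  simp [mk, Pi.single_apply, YX, YZ, YW, YY]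
lemma mk_Z : mk n hn a y ζ w (iZ n i) = ζ i := by
  simp [mk, Pi.single_apply, ZX, ZZ, ZW, ZY]
lemma mk_W : mk n hn a y ζ w (iW n hn) = w := by
  simp [mk, Pi.single_apply, WX, WY, WZ]

lemma sum_q (c : ℝ) : ∑ l, x l * (c * (x l / σ l)) = c * (p - zval n p x σ) := by
  simp only [zval, sub_sub_cancel, Finset.mul_sum]
  exact Finset.sum_congr rfl fun l _ => by ring

lemma nabla_X (hβ : 0 < β) (hσ : ∀ i, 0 < σ i) (hz : 0 < zval n p x σ) (A : ℝ)
    (hA : A = (∑ l, x l * v (iY n l) + v (iX n hn) * (p - zval n p x σ)) / (2 * zval n p x σ)) :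
    nabla n (Sform n p x σ β) (Pi.single (iX n hn) 1) v
     = mk n hn A (fun l => - (v (iX n hn) / 2 + A) * (x l / σ l)) 0 0 := by
  refine nabla_eq n _ _ p β x σ hn hβ hσ hz _ ?_
  refine idx_cases n hn ?_ (fun i => ?_) (fun i => ?_) ?_
  · simp [Sv_X, koszul, ip_eq n hn, bracket_X, bracket_Y n hn, bracket_Z n hn, bracket_W,
      Pi.single_apply, XY, YX, XZ, ZX, XW, WX, YZ, ZY, YW, WY, ZW, WZ, YY, ZZ, mk_X, mk_Y, mk_Z, mk_W,
      neg_div, ite_div, ite_mul]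
    have e : ∑ l, v (iY n l) / 2 * x l = (∑ l, x l * v (iY n l)) / 2 := by
      rw [Finset.sum_div]; exact Finset.sum_congr rfl fun l _ => by ring
    rw [sum_q (p := p), e, hA]
    field_simp
    ring
  · simp [Sv_Y n hn, koszul, ip_eq n hn, bracket_X, bracket_Y n hn, bracket_Z n hn, bracket_W,
      Pi.single_apply, XY, YX, XZ, ZX, XW, WX, YZ, ZY, YW, WY, ZW, WZ, YY, ZZ, mk_X, mk_Y, mk_Z, mk_W,
      neg_div, ite_div, ite_mul]
    have := (hσ i).ne'
    field_simp
    ring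
  · simp [Sv_Z (hn := hn), koszul, ip_eq n hn, bracket_X, bracket_Y n hn, bracket_Z n hn, bracket_W,
      Pi.single_apply, XY, YX, XZ, ZX, XW, WX, YZ, ZY, YW, WY, ZW, WZ, YY, ZZ, mk_X, mk_Y, mk_Z, mk_W,
      neg_div, ite_div, ite_mul]
    ring
  · simp [Sv_W, koszul, ip_eq n hn, bracket_X, bracket_Y n hn, bracket_Z n hn, bracket_W,
      Pi.single_apply, XY, YX, XZ, ZX, XW, WX, YZ, ZY, YW, WY, ZW, WZ, YY, ZZ, mk_X, mk_Y, mk_Z, mk_W,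
      neg_div, ite_div, ite_mul]
    ring

lemma nabla_Z (hβ : 0 < β) (hσ : ∀ i, 0 < σ i) (hz : 0 < zval n p x σ) (c B : ℝ)
    (hB : B = c * (σ i * v (iZ n i) + β * v (iW n hn) * (x i / σ i)) / (2 * zval n p x σ)) :
    nabla n (Sform n p x σ β) (Pi.single (iZ n i) c) v
     = mk n hn B (fun l => - ((if l = i then c * β * v (iW n hn) / 2 else 0) + x l * B) / σ l)
        (fun l => if l = i then - c * v (iX n hn) / 2 else 0) (c * v (iY n i) / 2) := by
  refine nabla_eq n _ _ p β x σ hn hβ hσ hz _ ?_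
  refine idx_cases n hn ?_ (fun j => ?_) (fun j => ?_) ?_
  · simp [Sv_X, koszul, ip_eq n hn, bracket_X, bracket_Y n hn, bracket_Z n hn, bracket_W,
      Pi.single_apply, XY, YX, XZ, ZX, XW, WX, YZ, ZY, YW, WY, ZW, WZ, YY, ZZ, mk_X, mk_Y, mk_Z, mk_W,
      neg_div, ite_div, ite_mul]
    have e : ∑ l, x l * ((-(x l * B) + -if l = i then c * β * v (iW n hn) / 2 else 0) / σ l)
        = - B * (p - zval n p x σ) - x i * (c * β * v (iW n hn) / 2) / σ i := by
      rw [← sum_q]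
      have : x i * (c * β * v (iW n hn) / 2) / σ i = ∑ l, if l = i then x l * (c * β * v (iW n hn) / 2) / σ l else 0 := by simp
      rw [this, ← Finset.sum_sub_distrib]
      exact Finset.sum_congr rfl fun l _ => by split_ifs <;> ring
    rw [e, hB]
    have := (hσ i).ne'
    field_simp
    ring
  · simp [Sv_Y n hn, koszul, ip_eq n hn, bracket_X, bracket_Y n hn, bracket_Z n hn, bracket_W,
      Pi.single_apply, XY, YX, XZ, ZX, XW, WX, YZ, ZY, YW, WY, ZW, WZ, YY, ZZ, mk_X, mk_Y, mk_Z, mk_W,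
      neg_div, ite_div, ite_mul]
    have := (hσ j).ne'
    by_cases h : j = i
    · subst h
      simp
      field_simp
      ring
    · simp [h, Ne.symm h]
      field_simp
      ring
  · simp [Sv_Z (hn := hn), koszul, ip_eq n hn, bracket_X, bracket_Y n hn, bracket_Z n hn, bracket_W,
      Pi.single_apply, XY, YX, XZ, ZX, XW, WX, YZ, ZY, YW, WY, ZW, WZ, YY, ZZ, mk_X, mk_Y, mk_Z, mk_W,
      neg_div, ite_div, ite_mul]
    by_cases h : j = i
    · subst h
      simp
      ring
    · simp [h, Ne.symm h]
  · simp [Sv_W, koszul, ip_eq n hn, bracket_X, bracket_Y n hn, bracket_Z n hn, bracket_W,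
      Pi.single_apply, XY, YX, XZ, ZX, XW, WX, YZ, ZY, YW, WY, ZW, WZ, YY, ZZ, mk_X, mk_Y, mk_Z, mk_W,
      neg_div, ite_div, ite_mul]
    ring

end


/-- `R(X, Z_i) = (1/(4zσ_i)) (-σ_i X∧Z_i - 2x_i X∧W + x_i Σ_l (x_l/σ_l) Y_l∧W + z Y_i∧W)`. -/
theorem curv_X_Z (n : ℕ) (hn : 2 ≤ n) (p β : ℝ) (x σ : Fin (n - 1) → ℝ)
    (hadm : Admissible n p x σ β) (hz : 0 < zval n p x σ) :
    let S := Sform n p x σ β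
    let z := zval n p x σ
    let X : Fin (2 * n) → ℝ := Pi.single ⟨0, by omega⟩ 1
    let Y : Fin (n - 1) → Fin (2 * n) → ℝ :=
      fun i => Pi.single ⟨i.val + 1, by have := i.isLt; omega⟩ 1
    let Z : Fin (n - 1) → Fin (2 * n) → ℝ :=
      fun i => Pi.single ⟨i.val + n, by have := i.isLt; omega⟩ 1
    let W : Fin (2 * n) → ℝ := Pi.single ⟨2 * n - 1, by omega⟩ 1
    ∀ i, curv n S X (Z i)
      = (1 / (4 * z * σ i)) •
          ((-(σ i)) • wedge n S X (Z i)
            - (2 * x i) • wedge n S X W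
            + x i • (∑ l, (x l / σ l) • wedge n S (Y l) W)
            + z • wedge n S (Y i) W) := by
  intro S z X Y Z W i
  obtain ⟨hp, hβ, hx, hanti, hσ1, -⟩ := hadm
  have hσ : ∀ i, 0 < σ i := fun i => lt_of_lt_of_le one_pos (hσ1 i)
  funext w
  have hb : bracket n X (Z i) = Pi.single (iZ n i) (1 / 2) := by
    funext k
    revert k
    change ∀ k, bracket n (Pi.single (iX n hn) 1) (Pi.single (iZ n i) 1) k = _
    refine idx_cases n hn ?_ (fun j => ?_) (fun j => ?_) ?_ <;>
    simp [bracket_X, bracket_Y n hn, bracket_Z n hn, bracket_W, Pi.single_apply,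
      XY, YX, XZ, ZX, XW, WX, YZ, ZY, YW, WY, ZW, WZ, YY, ZZ, ite_div]
  have key : curv n S X (Z i) w =
     nabla n S (Pi.single (iX n hn) 1) (nabla n S (Pi.single (iZ n i) 1) w)
     - nabla n S (Pi.single (iZ n i) 1) (nabla n S (Pi.single (iX n hn) 1) w)
     - nabla n S (Pi.single (iZ n i) (1 / 2)) w := by
    rw [← hb]; rfl
  rw [key]
  have hS : S = Sform n p x σ β := rfl
  have hX : X = Pi.single (iX n hn) 1 := rfl
  have hY : Y = fun i => Pi.single (iY n i) 1 := rfl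
  have hZ : Z = fun i => Pi.single (iZ n i) 1 := rfl
  have hW : W = Pi.single (iW n hn) 1 := rfl
  have hzz : z = zval n p x σ := rfl
  clear_value S X Y Z W z
  subst hS hX hY hZ hW
  set a := w (iX n hn) with ha
  set ω := w (iW n hn) with hω
  set D := ∑ l, x l * w (iY n l) with hD
  set A := (D + a * (p - z)) / (2 * z) with hA
  set B := (σ i * w (iZ n i) + β * ω * (x i / σ i)) / (2 * z) with hB
  have hz0 : z ≠ 0 := by rw [hzz]; exact hz.ne'
  have hi := (hσ i).ne'
  have s1 : ∑ l, x l * (-((if l = i then β * ω / 2 else 0) + x l * B) / σ l)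
      = - B * (p - z) - x i * (β * ω / 2) / σ i := by
    rw [hzz, ← sum_q]
    have : x i * (β * ω / 2) / σ i = ∑ l, if l = i then x l * (β * ω / 2) / σ l else 0 := by simp
    rw [this, ← Finset.sum_sub_distrib]
    exact Finset.sum_congr rfl fun l _ => by split_ifs <;> ring
  have n1 := nabla_Z n hn i w p β x σ hβ hσ hz 1 B (by rw [hB, hzz]; ring)
  have n2 := nabla_X n hn w p β x σ hβ hσ hz A (by rw [hA, hzz])
  have n3 := nabla_Z n hn i w p β x σ hβ hσ hz (1 / 2) (B / 2) (by rw [hB, hzz]; ring)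
  rw [n1, n2, n3]
  simp only [one_mul]
  rw [nabla_X n hn _ p β x σ hβ hσ hz ((- B * (p - z) - x i * (β * ω / 2) / σ i + B * (p - z)) / (2 * z))
    (by simp only [mk_X, mk_Y]; rw [s1, hzz])]
  rw [nabla_Z n hn i _ p β x σ hβ hσ hz 1 0 (by simp only [mk_Z, mk_W]; simp)]
  simp only [wedge, Finset.sum_apply, Pi.smul_apply, Pi.add_apply, Pi.sub_apply]
  funext k
  revert k
  refine idx_cases n hn ?_ (fun j => ?_) (fun j => ?_) ?_
  · simp [Finset.sum_apply, ip_eq n hn, Pi.single_apply, XY, YX, XZ, ZX, XW, WX, YZ, ZY, YW, WY, ZW, WZ, YY, ZZ, mk_X, mk_Y, mk_Z, mk_W]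
    rw [hB, ← hω]
    field_simp
    ring
  · simp [Finset.sum_apply, ip_eq n hn, Pi.single_apply, XY, YX, XZ, ZX, XW, WX, YZ, ZY, YW, WY, ZW, WZ, YY, ZZ, mk_X, mk_Y, mk_Z, mk_W]
    have hj := (hσ j).ne'
    rw [hB, ← hω]
    by_cases h : j = i
    · subst h
      simp only [if_true]
      field_simp
      ring
    · simp only [h, if_false]
      field_simp
      ring
  · simp [Finset.sum_apply, ip_eq n hn, Pi.single_apply, XY, YX, XZ, ZX, XW, WX, YZ, ZY, YW, WY, ZW, WZ, YY, ZZ, mk_X, mk_Y, mk_Z, mk_W]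
    by_cases h : j = i
    · subst h
      simp only [if_true]
      rw [← hD, ← ha, hA]
      field_simp
      ring
    · simp [h]
  · simp [Finset.sum_apply, ip_eq n hn, Pi.single_apply, XY, YX, XZ, ZX, XW, WX, YZ, ZY, YW, WY, ZW, WZ, YY, ZZ, mk_X, mk_Y, mk_Z, mk_W]
    have e : ∑ l, x l / σ l * (-(σ l * w (iY n l)) + -(x l * w (iX n hn))) = - D - a * (p - z) := by
      rw [hzz, ← sum_q, hD, ← Finset.sum_neg_distrib, ← Finset.sum_sub_distrib]
      refine Finset.sum_congr rfl fun l _ => ?_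
      have := (hσ l).ne'
      rw [← ha]
      field_simp
      ring
    rw [e, ← hD, ← ha, hA]
    field_simp
    ring

end CHn
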